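/- Let R be a (possibly noncommutative) unital ring, let X, Y ∈ R, and set C := Y·X − X·Y. Assume X·C = C·X and Y·C = C·Y. Then for every natural number n, (X+Y)^n = ∑_{k=0}^{⌊n/2⌋} (n!/((n−2k)!·k!·2^k)) · B_{n−2k}(X,Y) · C^k, where each coefficient n!/((n−2k)!·k!·2^k) = C(n,2k)·(2k−1)!! is a positive integer acting by the natural ℕ-scalar action on R. -/

import Mathlib

/-- The `n`-th binomial operator `B_n(X,Y) = ∑_{k=0}^n C(n,k) X^k Y^{n-k}` for possibly
noncommuting elements of a ring. -/
def binomialOp {R : Type*} [Ring R] (X Y : R) (n : ℕ) : R :=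
  ∑ k ∈ Finset.range (n + 1), Nat.choose n k • (X ^ k * Y ^ (n - k))

theorem binomialOp_zero {R : Type*} [Ring R] (X Y : R) : binomialOp X Y 0 = 1 := by
  simp [binomialOp]

/-- Pascal's rule for binomial operators. -/
theorem binomialOp_succ {R : Type*} [Ring R] (X Y : R) (n : ℕ) :
    binomialOp X Y (n + 1) = X * binomialOp X Y n + binomialOp X Y n * Y := by
  have hX : X * binomialOp X Y n =
      ∑ k ∈ Finset.range (n + 1), n.choose k • (X ^ (k + 1) * Y ^ (n - k)) := by
    simp only [binomialOp, Finset.mul_sum, mul_smul_comm, pow_succ', mul_assoc]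
  have hY : binomialOp X Y n * Y =
      ∑ k ∈ Finset.range (n + 1), n.choose (k + 1) • (X ^ (k + 1) * Y ^ (n - k)) +
        Y ^ (n + 1) := by
    rw [Finset.sum_range_succ, Nat.choose_succ_self, zero_smul, add_zero, binomialOp,
      Finset.sum_range_succ', add_mul, Finset.sum_mul]
    congr 1
    · refine Finset.sum_congr rfl fun k hk => ?_
      rw [smul_mul_assoc, mul_assoc, ← pow_succ]
      have := Finset.mem_range.mp hk
      congr 3
      omega
    · simp [pow_succ]
  rw [hX, hY, binomialOp, Finset.sum_range_succ', ← add_assoc, ← Finset.sum_add_distrib]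
  simp [Nat.choose_succ_succ, add_smul]

theorem mul_pow_of_commute_commutator {R : Type*} [Ring R] {X Y C : R}
    (hC : C = Y * X - X * Y) (hXC : X * C = C * X) (k : ℕ) :
    Y * X ^ k = X ^ k * Y + k • (X ^ (k - 1) * C) := by
  have hYX : Y * X = X * Y + C := by rw [hC]; abel
  induction k with
  | zero => simp
  | succ k ih =>
    have hk : k • (X ^ (k - 1) * C * X) = k • (X ^ k * C) := by
      cases k with
      | zero => simp
      | succ m => rw [mul_assoc, ← hXC, ← mul_assoc, Nat.add_sub_cancel, ← pow_succ]
    rw [pow_succ, ← mul_assoc, ih, add_mul, smul_mul_assoc, hk, mul_assoc, hYX, mul_add,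
      Nat.add_sub_cancel, succ_nsmul', mul_assoc, add_assoc]

/-- Moving `Y` across a binomial operator from left to right. -/
theorem mul_binomialOp {R : Type*} [Ring R] {X Y C : R}
    (hC : C = Y * X - X * Y) (hXC : X * C = C * X) (hYC : Y * C = C * Y) (n : ℕ) :
    Y * binomialOp X Y n = binomialOp X Y n * Y + n • (binomialOp X Y (n - 1) * C) := by
  have h : ∀ k, Y * (X ^ k * Y ^ (n - k)) =
      X ^ k * Y ^ (n - k) * Y + k • (X ^ (k - 1) * Y ^ (n - k) * C) := fun k => by
    rw [← mul_assoc, mul_pow_of_commute_commutator hC hXC, add_mul, smul_mul_assoc,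
      mul_assoc, mul_assoc, mul_assoc, mul_assoc, ← pow_succ, ← pow_succ',
      (Commute.pow_left (show Commute Y C from hYC) (n - k)).eq]
  have hsum : ∑ k ∈ Finset.range (n + 1),
      n.choose k • k • (X ^ (k - 1) * Y ^ (n - k) * C) = n • (binomialOp X Y (n - 1) * C) := by
    cases n with
    | zero => simp
    | succ m =>
      rw [Finset.sum_range_succ', zero_smul, smul_zero, add_zero, Nat.add_sub_cancel,
        binomialOp, Finset.sum_mul, Finset.smul_sum]
      refine Finset.sum_congr rfl fun k _ => ?_
      rw [smul_mul_assoc, smul_smul, smul_smul, Nat.add_sub_cancel, Nat.add_sub_add_right,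
        ← Nat.add_one_mul_choose_eq]
  rw [← hsum]
  simp only [binomialOp, Finset.mul_sum, Finset.sum_mul, mul_smul_comm, smul_mul_assoc, h,
    smul_add, Finset.sum_add_distrib]

theorem add_mul_binomialOp {R : Type*} [Ring R] {X Y C : R}
    (hC : C = Y * X - X * Y) (hXC : X * C = C * X) (hYC : Y * C = C * Y) (n : ℕ) :
    (X + Y) * binomialOp X Y n =
      binomialOp X Y (n + 1) + n • (binomialOp X Y (n - 1) * C) := by
  rw [add_mul, mul_binomialOp hC hXC hYC, binomialOp_succ, add_assoc]

/-- Recurrence for the number of `(k+1)`-edge matchings of the complete graph on `n+1` vertices. -/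
theorem choose_mul_doubleFactorial_succ (n k : ℕ) :
    (n + 1).choose (2 * (k + 1)) * (2 * (k + 1) - 1).doubleFactorial =
      n.choose (2 * (k + 1)) * (2 * (k + 1) - 1).doubleFactorial +
        n.choose (2 * k) * (2 * k - 1).doubleFactorial * (n - 2 * k) := by
  have hdf : (2 * (k + 1) - 1).doubleFactorial = (2 * k + 1) * (2 * k - 1).doubleFactorial := by
    cases k with
    | zero => rfl
    | succ k => exact Nat.doubleFactorial_add_two (2 * k + 1)
  have hch : n.choose (2 * k + 1) * (2 * k + 1) = n.choose (2 * k) * (n - 2 * k) :=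
    Nat.choose_succ_right_eq n (2 * k)
  rw [show 2 * (k + 1) = 2 * k + 1 + 1 by ring, Nat.choose_succ_succ,
    ← show 2 * (k + 1) = 2 * k + 1 + 1 by ring, hdf]
  linear_combination (2 * k - 1).doubleFactorial * hch

/-- The closed form, with the summation range padded by vanishing terms. -/
theorem add_pow_eq_sum_binomialOp {R : Type*} [Ring R] {X Y C : R}
    (hC : C = Y * X - X * Y) (hXC : X * C = C * X) (hYC : Y * C = C * Y) (n : ℕ) :
    (X + Y) ^ n =
      ∑ k ∈ Finset.range (n + 1),
        (n.choose (2 * k) * (2 * k - 1).doubleFactorial) •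
          (binomialOp X Y (n - 2 * k) * C ^ k) := by
  induction n with
  | zero => simp [binomialOp_zero]
  | succ n ih =>
    have hterm : ∀ k, (X + Y) * ((n.choose (2 * k) * (2 * k - 1).doubleFactorial) •
          (binomialOp X Y (n - 2 * k) * C ^ k)) =
        (n.choose (2 * k) * (2 * k - 1).doubleFactorial) •
          (binomialOp X Y (n + 1 - 2 * k) * C ^ k) +
        (n.choose (2 * k) * (2 * k - 1).doubleFactorial * (n - 2 * k)) •
          (binomialOp X Y (n + 1 - 2 * (k + 1)) * C ^ (k + 1)) := fun k => by
      rcases lt_or_ge n (2 * k) with hk | hk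
      · simp [Nat.choose_eq_zero_of_lt hk]
      · rw [mul_smul_comm, ← mul_assoc, add_mul_binomialOp hC hXC hYC, add_mul, smul_add,
          smul_mul_assoc, smul_smul, mul_assoc (binomialOp X Y _) C, ← pow_succ',
          show n - 2 * k + 1 = n + 1 - 2 * k by omega,
          show n - 2 * k - 1 = n + 1 - 2 * (k + 1) by omega]
    rw [pow_succ', ih, Finset.mul_sum, Finset.sum_congr rfl fun k _ => hterm k,
      Finset.sum_add_distrib, Finset.sum_range_succ' _ (n + 1)]
    simp only [choose_mul_doubleFactorial_succ, add_smul, Finset.sum_add_distrib]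
    rw [add_right_comm]
    congr 1
    have hlast : n.choose (2 * (n + 1)) = 0 := Nat.choose_eq_zero_of_lt (by omega)
    rw [Finset.sum_range_succ' _ n, Finset.sum_range_succ _ n, hlast]
    simp

/-- Closed-form noncommutative binomial expansion when `C = [Y,X]` is central for `X` and `Y`:
`(X+Y)^n = ∑_{k=0}^{⌊n/2⌋} C(n,2k)(2k-1)!! ⬝ B_{n-2k}(X,Y) C^k`. -/
theorem noncomm_binomial_closed_form (R : Type*) [Ring R] (X Y C : R)
    (hC : C = Y * X - X * Y) (hXC : X * C = C * X) (hYC : Y * C = C * Y) (n : ℕ) :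
    (X + Y) ^ n =
      ∑ k ∈ Finset.range (n / 2 + 1),
        (Nat.choose n (2 * k) * Nat.doubleFactorial (2 * k - 1)) •
          (binomialOp X Y (n - 2 * k) * C ^ k) := by
  rw [add_pow_eq_sum_binomialOp hC hXC hYC]
  symm
  refine Finset.sum_subset (Finset.range_mono (by omega)) fun k _ hk => ?_
  rw [Finset.mem_range, not_lt] at hk
  rw [Nat.choose_eq_zero_of_lt (by omega), zero_mul, zero_smul]
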